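/- As x → ∞, ∫_1^{x^{1/4}} f₂(t) dt = 2^{−1/3}·(3x)^{1/2}·G₂(0) − 3^{4/3}·2^{−1}·x^{1/3} + O(x^{−1/3}). -/

import Mathlib

open Real Filter Asymptotics

/-- f₂(t) = t·[(3x/(2t⁴) + (1/2)√((3x/t⁴)² − 1/432))^{1/3}
  + (3x/(2t⁴) − (1/2)√((3x/t⁴)² − 1/432))^{1/3}]. -/
noncomputable def f2 (x t : ℝ) : ℝ :=
  t * ((3 * x / (2 * t ^ 4) + (1/2) * Real.sqrt ((3 * x / t ^ 4) ^ 2 - 1/432)) ^ ((1:ℝ)/3)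
    + (3 * x / (2 * t ^ 4) - (1/2) * Real.sqrt ((3 * x / t ^ 4) ^ 2 - 1/432)) ^ ((1:ℝ)/3))

/-- G₂(y) = ∫_y^{3^{−1/4}} t^{−1/3}·[(1 + √(1 − t⁸/432))^{1/3} + (1 − √(1 − t⁸/432))^{1/3}] dt. -/
noncomputable def G2 (y : ℝ) : ℝ :=
  ∫ t in y..(3:ℝ) ^ (-(1:ℝ)/4),
    t ^ (-(1:ℝ)/3) * ((1 + Real.sqrt (1 - t ^ 8 / 432)) ^ ((1:ℝ)/3)
      + (1 - Real.sqrt (1 - t ^ 8 / 432)) ^ ((1:ℝ)/3))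

open MeasureTheory

/-- The sum of cube roots in the integrand of `G2`. -/
noncomputable def cubeRootSum (s : ℝ) : ℝ :=
  (1 + √(1 - s ^ 8 / 432)) ^ ((1:ℝ)/3) + (1 - √(1 - s ^ 8 / 432)) ^ ((1:ℝ)/3)

lemma sqrt_one_sub_le_one (s : ℝ) : √(1 - s ^ 8 / 432) ≤ 1 := by
  have : 0 ≤ s ^ 8 := by positivity
  exact Real.sqrt_le_one.2 (by linarith)

lemma continuous_cubeRootSum : Continuous cubeRootSum := by
  unfold cubeRootSum
  have hr : Continuous fun s : ℝ => √(1 - s ^ 8 / 432) := by fun_prop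
  exact ((continuous_const.add hr).rpow_const fun _ => Or.inr (by norm_num)).add
    ((continuous_const.sub hr).rpow_const fun _ => Or.inr (by norm_num))

lemma intervalIntegrable_rpow_mul_cubeRootSum (a b : ℝ) :
    IntervalIntegrable (fun s : ℝ => s ^ (-(1:ℝ)/3) * cubeRootSum s) volume a b :=
  (intervalIntegral.intervalIntegrable_rpow' (by norm_num)).mul_continuousOn
    continuous_cubeRootSum.continuousOn

lemma le_cubeRootSum (s : ℝ) : (2:ℝ) ^ ((1:ℝ)/3) ≤ cubeRootSum s := by
  have h := Real.rpow_add_le_add_rpow (p := (1:ℝ)/3)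
    (add_nonneg zero_le_one (Real.sqrt_nonneg (1 - s ^ 8 / 432)))
    (sub_nonneg.2 (sqrt_one_sub_le_one s)) (by norm_num) (by norm_num)
  unfold cubeRootSum
  convert h using 2
  ring

lemma cubeRootSum_le {s : ℝ} (h0 : 0 ≤ s) (h1 : s ≤ 1) :
    cubeRootSum s ≤ (2:ℝ) ^ ((1:ℝ)/3) + s ^ ((8:ℝ)/3) := by
  have hr0 := Real.sqrt_nonneg (1 - s ^ 8 / 432)
  have hr1 := sqrt_one_sub_le_one s
  have hs8 : 0 ≤ s ^ 8 := by positivity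
  have hs8' : s ^ 8 ≤ 1 := pow_le_one₀ h0 h1
  have hsq : √(1 - s ^ 8 / 432) ^ 2 = 1 - s ^ 8 / 432 := Real.sq_sqrt (by linarith)
  have hpow : s ^ ((8:ℝ)/3) = (s ^ 8) ^ ((1:ℝ)/3) := by
    rw [← Real.rpow_natCast, ← Real.rpow_mul h0]
    norm_num
  rw [hpow]
  unfold cubeRootSum
  gcongr
  · linarith
  · nlinarith

lemma f2_scaled {x s : ℝ} (hx : 0 < x) (h0 : 0 < s) :
    f2 x ((3 * x) ^ ((1:ℝ)/4) * s) =
      (3 * x) ^ ((1:ℝ)/4) * 2 ^ (-(1:ℝ)/3) * (s ^ (-(1:ℝ)/3) * cubeRootSum s) := by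
  have hc : ((3 * x) ^ ((1:ℝ)/4)) ^ 4 = 3 * x := by
    rw [← Real.rpow_natCast, ← Real.rpow_mul (by positivity)]
    norm_num
  have hq : 3 * x / ((3 * x) ^ ((1:ℝ)/4) * s) ^ 4 = (s ^ 4)⁻¹ := by
    rw [mul_pow, hc]
    field_simp
  have hq2 : 3 * x / (2 * ((3 * x) ^ ((1:ℝ)/4) * s) ^ 4) = (s ^ 4)⁻¹ / 2 := by
    rw [← hq]
    field_simp
  have hsqrt : √((s ^ 4)⁻¹ ^ 2 - 1 / 432) = (s ^ 4)⁻¹ * √(1 - s ^ 8 / 432) := by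
    rw [← Real.sqrt_sq (inv_nonneg.2 (pow_nonneg h0.le 4)), ← Real.sqrt_mul (by positivity),
      Real.sqrt_sq (inv_nonneg.2 (pow_nonneg h0.le 4))]
    congr 1
    field_simp
  have hpow : s * ((s ^ 4)⁻¹ / 2) ^ ((1:ℝ)/3) = 2 ^ (-(1:ℝ)/3) * s ^ (-(1:ℝ)/3) := by
    have e : (s ^ 4)⁻¹ = s ^ (-4:ℝ) := by
      rw [Real.rpow_neg h0.le]
      norm_cast
    rw [e, div_eq_mul_inv, Real.mul_rpow (by positivity) (by positivity), ← Real.rpow_mul h0.le,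
      ← Real.rpow_neg_one, ← Real.rpow_mul (by positivity), ← mul_assoc]
    nth_rewrite 1 [← Real.rpow_one s]
    rw [← Real.rpow_add h0, mul_comm]
    norm_num
  have hr0 := Real.sqrt_nonneg (1 - s ^ 8 / 432)
  have hr1 := sqrt_one_sub_le_one s
  unfold f2 cubeRootSum
  rw [hq, hq2, hsqrt]
  have e1 : (s ^ 4)⁻¹ / 2 + 1 / 2 * ((s ^ 4)⁻¹ * √(1 - s ^ 8 / 432)) =
    (s ^ 4)⁻¹ / 2 * (1 + √(1 - s ^ 8 / 432)) := by ring
  have e2 : (s ^ 4)⁻¹ / 2 - 1 / 2 * ((s ^ 4)⁻¹ * √(1 - s ^ 8 / 432)) =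
    (s ^ 4)⁻¹ / 2 * (1 - √(1 - s ^ 8 / 432)) := by ring
  rw [e1, e2, Real.mul_rpow (x := (s ^ 4)⁻¹ / 2) (by positivity) (by linarith),
    Real.mul_rpow (x := (s ^ 4)⁻¹ / 2) (by positivity) (by linarith)]
  linear_combination (3 * x) ^ ((1:ℝ)/4) * ((1 + √(1 - s ^ 8 / 432)) ^ ((1:ℝ)/3)
    + (1 - √(1 - s ^ 8 / 432)) ^ ((1:ℝ)/3)) * hpow

lemma integral_f2_eq {x : ℝ} (hx : 0 < x) :
    ∫ t in (1:ℝ)..x ^ ((1:ℝ)/4), f2 x t =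
      2 ^ (-(1:ℝ)/3) * (3 * x) ^ ((1:ℝ)/2) * G2 ((3 * x) ^ (-(1:ℝ)/4)) := by
  have h3x : 0 < 3 * x := by positivity
  have ha : (3 * x) ^ ((1:ℝ)/4) * (3 * x) ^ (-(1:ℝ)/4) = 1 := by
    rw [← Real.rpow_add h3x]
    norm_num
  have hb : (3 * x) ^ ((1:ℝ)/4) * 3 ^ (-(1:ℝ)/4) = x ^ ((1:ℝ)/4) := by
    rw [Real.mul_rpow (by norm_num) hx.le, mul_right_comm, ← Real.rpow_add (by norm_num)]
    norm_num
  have hc : (3 * x) ^ ((1:ℝ)/4) * (3 * x) ^ ((1:ℝ)/4) = (3 * x) ^ ((1:ℝ)/2) := by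
    rw [← Real.rpow_add h3x]
    norm_num
  have hsubst := intervalIntegral.mul_integral_comp_mul_left (a := (3 * x) ^ (-(1:ℝ)/4))
    (b := 3 ^ (-(1:ℝ)/4)) (f := f2 x) ((3 * x) ^ ((1:ℝ)/4))
  rw [ha, hb] at hsubst
  rw [← hsubst, intervalIntegral.integral_congr (g := fun s =>
    (3 * x) ^ ((1:ℝ)/4) * 2 ^ (-(1:ℝ)/3) * (s ^ (-(1:ℝ)/3) * cubeRootSum s)),
    intervalIntegral.integral_const_mul, ← hc]
  · simp only [G2, cubeRootSum]
    ring
  · intro s hs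
    exact f2_scaled hx ((lt_inf_iff.2 ⟨by positivity, by positivity⟩).trans_le hs.1)

lemma G2_zero_sub (y : ℝ) :
    G2 0 - G2 y = ∫ s in (0:ℝ)..y, s ^ (-(1:ℝ)/3) * cubeRootSum s := by
  rw [sub_eq_iff_eq_add]
  exact (intervalIntegral.integral_add_adjacent_intervals
    (intervalIntegrable_rpow_mul_cubeRootSum 0 y)
    (intervalIntegrable_rpow_mul_cubeRootSum y _)).symm

lemma integral_rpow_mul_cubeRootSum_bounds {y : ℝ} (h0 : 0 ≤ y) (h1 : y ≤ 1) :
    2 ^ ((1:ℝ)/3) * (3 / 2 * y ^ ((2:ℝ)/3)) ≤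
        (∫ s in (0:ℝ)..y, s ^ (-(1:ℝ)/3) * cubeRootSum s) ∧
      (∫ s in (0:ℝ)..y, s ^ (-(1:ℝ)/3) * cubeRootSum s) ≤
        2 ^ ((1:ℝ)/3) * (3 / 2 * y ^ ((2:ℝ)/3)) + 3 / 10 * y ^ ((10:ℝ)/3) := by
  have hi : IntervalIntegrable (fun s : ℝ => (2:ℝ) ^ ((1:ℝ)/3) * s ^ (-(1:ℝ)/3)) volume 0 y :=
    (intervalIntegral.intervalIntegrable_rpow' (by norm_num)).const_mul _
  have hi' : IntervalIntegrable (fun s : ℝ => s ^ ((7:ℝ)/3)) volume 0 y :=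
    intervalIntegral.intervalIntegrable_rpow' (by norm_num)
  have hmain : ∫ s in (0:ℝ)..y, (2:ℝ) ^ ((1:ℝ)/3) * s ^ (-(1:ℝ)/3) =
      2 ^ ((1:ℝ)/3) * (3 / 2 * y ^ ((2:ℝ)/3)) := by
    rw [intervalIntegral.integral_const_mul, integral_rpow (Or.inl (by norm_num))]
    norm_num
    ring
  have hrem : ∫ s in (0:ℝ)..y, s ^ ((7:ℝ)/3) = 3 / 10 * y ^ ((10:ℝ)/3) := by
    rw [integral_rpow (Or.inl (by norm_num))]
    norm_num
    ring
  rw [← hmain, ← hrem, ← intervalIntegral.integral_add hi hi']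
  constructor
  · refine intervalIntegral.integral_mono_on h0 hi
      (intervalIntegrable_rpow_mul_cubeRootSum _ _) fun s hs => ?_
    rw [mul_comm]
    exact mul_le_mul_of_nonneg_left (le_cubeRootSum s) (Real.rpow_nonneg hs.1 _)
  · refine intervalIntegral.integral_mono_on_of_le_Ioo h0
      (intervalIntegrable_rpow_mul_cubeRootSum _ _) (hi.add hi') fun s hs => ?_
    have e : s ^ ((7:ℝ)/3) = s ^ (-(1:ℝ)/3) * s ^ ((8:ℝ)/3) := by
      rw [← Real.rpow_add hs.1]
      norm_num
    rw [e, mul_comm (2 ^ _), ← mul_add]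
    exact mul_le_mul_of_nonneg_left (cubeRootSum_le hs.1.le (hs.2.le.trans h1))
      (Real.rpow_nonneg hs.1.le _)

theorem integral_f2_asymptotic :
    (fun x : ℝ => (∫ t in (1:ℝ)..x ^ ((1:ℝ)/4), f2 x t)
        - 2 ^ (-(1:ℝ)/3) * (3 * x) ^ ((1:ℝ)/2) * G2 0
        + 3 ^ ((4:ℝ)/3) * 2⁻¹ * x ^ ((1:ℝ)/3))
      =O[atTop] fun x : ℝ => x ^ (-(1:ℝ)/3) := by
  refine IsBigO.of_bound (2 ^ (-(1:ℝ)/3) * (3 / 10) * 3 ^ (-(1:ℝ)/3)) ?_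
  filter_upwards [eventually_ge_atTop 1] with x hx
  have hx0 : 0 < x := by linarith
  have h3x : 0 < 3 * x := by positivity
  obtain ⟨hlow, hupp⟩ := integral_rpow_mul_cubeRootSum_bounds
    (y := (3 * x) ^ (-(1:ℝ)/4)) (by positivity)
    (Real.rpow_le_one_of_one_le_of_nonpos (by linarith) (by norm_num))
  rw [← G2_zero_sub] at hlow hupp
  rw [← Real.rpow_mul h3x.le] at hlow
  rw [← Real.rpow_mul h3x.le, ← Real.rpow_mul h3x.le] at hupp
  have hk : (0:ℝ) ≤ 2 ^ (-(1:ℝ)/3) * (3 * x) ^ ((1:ℝ)/2) := by positivity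
  have hlow' := mul_le_mul_of_nonneg_left hlow hk
  have hupp' := mul_le_mul_of_nonneg_left hupp hk
  have htwo : (2:ℝ) ^ (-(1:ℝ)/3) * 2 ^ ((1:ℝ)/3) = 1 := by
    rw [← Real.rpow_add (by norm_num)]
    norm_num
  have hthree : (3:ℝ) ^ ((4:ℝ)/3) = 3 * 3 ^ ((1:ℝ)/3) := by
    rw [← Real.rpow_one_add' (by norm_num) (by norm_num)]
    norm_num
  have hmain : (3 * x) ^ ((1:ℝ)/2) * (3 * x) ^ (-(1:ℝ)/4 * (2/3)) =
      3 ^ ((1:ℝ)/3) * x ^ ((1:ℝ)/3) := by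
    rw [← Real.rpow_add h3x, ← Real.mul_rpow (by norm_num) hx0.le]
    norm_num
  have hrem : (3 * x) ^ ((1:ℝ)/2) * (3 * x) ^ (-(1:ℝ)/4 * (10/3)) =
      3 ^ (-(1:ℝ)/3) * x ^ (-(1:ℝ)/3) := by
    rw [← Real.rpow_add h3x, ← Real.mul_rpow (by norm_num) hx0.le]
    norm_num
  have hM : 2 ^ (-(1:ℝ)/3) * (3 * x) ^ ((1:ℝ)/2) *
      (2 ^ ((1:ℝ)/3) * (3 / 2 * (3 * x) ^ (-(1:ℝ)/4 * (2/3)))) =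
      3 ^ ((4:ℝ)/3) * 2⁻¹ * x ^ ((1:ℝ)/3) := by
    rw [hthree]
    linear_combination (3 / 2 * ((3 * x) ^ ((1:ℝ)/2) * (3 * x) ^ (-(1:ℝ)/4 * (2/3)))) * htwo
      + 3 / 2 * hmain
  have hR : 2 ^ (-(1:ℝ)/3) * (3 * x) ^ ((1:ℝ)/2) *
      (3 / 10 * (3 * x) ^ (-(1:ℝ)/4 * (10/3))) =
      2 ^ (-(1:ℝ)/3) * (3 / 10) * 3 ^ (-(1:ℝ)/3) * x ^ (-(1:ℝ)/3) := by
    linear_combination (2 ^ (-(1:ℝ)/3) * (3 / 10)) * hrem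
  rw [hM] at hlow'
  rw [mul_add, hM, hR] at hupp'
  have hpos : 0 ≤ 2 ^ (-(1:ℝ)/3) * (3 / 10) * 3 ^ (-(1:ℝ)/3) * x ^ (-(1:ℝ)/3) := by positivity
  rw [integral_f2_eq hx0, Real.norm_eq_abs, Real.norm_of_nonneg (Real.rpow_nonneg hx0.le _),
    abs_le]
  constructor <;> linarith
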